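/- Let d ≥ 1, let P be a polynomial in d real variables with P(x) ≥ 0 for every x ∈ ℝ^d, and let 1 < q < ∞. Then P belongs to the reverse Hölder class RH_q(ℝ^d): there exists C > 0 such that for every ball B in ℝ^d, ( |B|^{−1} ∫_B P(x)^q dx )^{1/q} ≤ C |B|^{−1} ∫_B P(x) dx. -/

import Mathlib

open MeasureTheory Metric

noncomputable section

/-- The Lebesgue measure `|B(x,r)|` of a ball in `ℝ^d`, as a real number. -/
noncomputable def ballVol (d : ℕ) (x : EuclideanSpace ℝ (Fin d)) (r : ℝ) : ℝ :=
  (volume (ball x r)).toReal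

/-- On a finite-dimensional space of continuous functions that are determined by their values
on an open set `U`, the `L¹` norm on `U` controls the supremum on any compact set. -/
theorem exists_forall_abs_le_mul_setIntegral_abs {X V : Type*} [TopologicalSpace X]
    [MeasurableSpace X] [BorelSpace X] [AddCommGroup V] [Module ℝ V] [FiniteDimensional ℝ V]
    (μ : Measure X) [μ.IsOpenPosMeasure] [IsFiniteMeasureOnCompacts μ]
    (T : V →ₗ[ℝ] C(X, ℝ)) {U K : Set X} (hU : IsOpen U) (hK : IsCompact K) (hUK : U ⊆ K)
    (hKm : MeasurableSet K) (hT : ∀ v, (∀ y ∈ U, T v y = 0) → v = 0) :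
    ∃ C > (0 : ℝ), ∀ v, ∀ y ∈ K, |T v y| ≤ C * ∫ z in U, |T v z| ∂μ := by
  have hint (f : C(X, ℝ)) : Integrable f (μ.restrict U) :=
    (f.continuous.continuousOn.integrableOn_compact' hK hKm).mono_set hUK
  let b := Module.finBasis ℝ V
  let e := b.equivFun.symm
  let S : (Fin (Module.finrank ℝ V) → ℝ) →ₗ[ℝ] (X →₁[μ.restrict U] ℝ) :=
    { toFun := fun c => (hint (T (e c))).toL1 _
      map_add' := fun c c' => by
        rw [← Integrable.toL1_add]
        exact (Integrable.toL1_eq_toL1_iff _ _ _ _).2 (by simp)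
      map_smul' := fun a c => by
        rw [RingHom.id_apply, ← Integrable.toL1_smul]
        exact (Integrable.toL1_eq_toL1_iff _ _ _ _).2 (by simp; rfl) }
  have hS : LinearMap.ker S = ⊥ := by
    refine (LinearMap.ker_eq_bot').2 fun c hc => ?_
    have h0 : T (e c) =ᵐ[μ.restrict U] (0 : X → ℝ) := by
      rw [← Integrable.toL1_eq_toL1_iff _ _ (hint _) (integrable_zero _ _ _),
        Integrable.toL1_zero]
      exact hc
    have h1 := Measure.eqOn_open_of_ae_eq h0 hU (T (e c)).continuous.continuousOn
      continuousOn_const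
    exact e.map_eq_zero_iff.1 (hT _ fun y hy => h1 hy)
  obtain ⟨L, -, hL⟩ := S.exists_antilipschitzWith hS
  have hbound (i) : ∃ M, ∀ y ∈ K, ‖T (b i) y‖ ≤ M :=
    hK.exists_bound_of_continuousOn (T (b i)).continuous.continuousOn
  choose M hM using hbound
  refine ⟨L * ∑ i, |M i| + 1, by positivity, fun v y hy => ?_⟩
  set I := ∫ z in U, |T v z| ∂μ
  have hI : 0 ≤ I := integral_nonneg fun _ => abs_nonneg _
  have hc : ‖b.equivFun v‖ ≤ L * I := by
    have h := hL.le_mul_dist (b.equivFun v) 0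
    rw [map_zero, dist_zero_right, dist_zero_right] at h
    refine h.trans_eq ?_
    congr 1
    change ‖(hint (T (e (b.equivFun v)))).toL1 _‖ = I
    rw [L1.norm_of_fun_eq_integral_norm]
    simp [e, I]
  calc |T v y| = |∑ i, b.equivFun v i * T (b i) y| := by
        conv_lhs => rw [← b.sum_equivFun v, map_sum, ContinuousMap.sum_apply]
        simp only [map_smul, ContinuousMap.smul_apply, smul_eq_mul]
    _ ≤ ∑ i, ‖b.equivFun v‖ * |M i| := by
        refine (Finset.abs_sum_le_sum_abs _ _).trans (Finset.sum_le_sum fun i _ => ?_)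
        rw [abs_mul]
        exact mul_le_mul (norm_le_pi_norm (b.equivFun v) i) ((hM i y hy).trans (le_abs_self _))
          (abs_nonneg _) (norm_nonneg _)
    _ = ‖b.equivFun v‖ * ∑ i, |M i| := by rw [Finset.mul_sum]
    _ ≤ L * I * ∑ i, |M i| := by gcongr
    _ ≤ (L * ∑ i, |M i| + 1) * I := by nlinarith

/-- Substituting polynomials of total degree at most one does not raise the total degree. -/
theorem totalDegree_aeval_le_of_forall_le_one {σ τ R : Type*} [CommSemiring R]
    (f : σ → MvPolynomial τ R) (hf : ∀ i, (f i).totalDegree ≤ 1) (P : MvPolynomial σ R) :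
    (MvPolynomial.aeval f P).totalDegree ≤ P.totalDegree := by
  rw [MvPolynomial.aeval_def, MvPolynomial.eval₂_eq]
  refine MvPolynomial.totalDegree_finsetSum_le fun m hm => ?_
  refine (MvPolynomial.totalDegree_mul _ _).trans ?_
  rw [MvPolynomial.algebraMap_eq, MvPolynomial.totalDegree_C, zero_add]
  refine (MvPolynomial.totalDegree_finsetProd _ _).trans
    (le_trans (Finset.sum_le_sum fun i _ => ?_) (MvPolynomial.le_totalDegree hm))
  exact (MvPolynomial.totalDegree_pow _ _).trans (by nlinarith [hf i])

/-- A polynomial vanishing on a nonempty open subset of `ℝ^d` is zero. -/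
theorem eq_zero_of_eval_eq_zero_of_isOpen {σ : Type*} [Finite σ] {U : Set (σ → ℝ)}
    (hU : IsOpen U) (hne : U.Nonempty) {P : MvPolynomial σ ℝ}
    (h : ∀ x ∈ U, MvPolynomial.eval x P = 0) : P = 0 := by
  have := Fintype.ofFinite σ
  obtain ⟨x, hx⟩ := hne
  obtain ⟨ε, hε, hsub⟩ := Metric.isOpen_iff.1 hU x hx
  refine MvPolynomial.funext_set (fun i => ball (x i) ε)
    (fun i => infinite_of_mem_nhds (x i) (ball_mem_nhds _ hε)) fun y hy => ?_
  rw [map_zero]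
  exact h y (hsub (by rwa [ball_pi _ hε]))

/-- Evaluation of polynomials on Euclidean space, as continuous functions. -/
def evalContinuousMap (d : ℕ) : MvPolynomial (Fin d) ℝ →ₗ[ℝ] C(EuclideanSpace ℝ (Fin d), ℝ) where
  toFun P := ⟨fun y => MvPolynomial.eval (fun i => y i) P,
    (MvPolynomial.continuous_eval P).comp (by fun_prop)⟩
  map_add' P Q := by ext; simp
  map_smul' a P := by ext; simp

@[simp]
theorem evalContinuousMap_apply (d : ℕ) (P : MvPolynomial (Fin d) ℝ)
    (y : EuclideanSpace ℝ (Fin d)) :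
    evalContinuousMap d P y = MvPolynomial.eval (fun i => y i) P := rfl

theorem ballVol_pos (d : ℕ) (x : EuclideanSpace ℝ (Fin d)) {r : ℝ} (hr : 0 < r) :
    0 < ballVol d x r :=
  ENNReal.toReal_pos (measure_ball_pos volume x hr).ne' measure_ball_lt_top.ne

/-- Averages over balls are invariant under the affine change of variables onto the unit ball. -/
theorem inv_ballVol_mul_setIntegral (d : ℕ) (x : EuclideanSpace ℝ (Fin d)) {r : ℝ} (hr : 0 < r)
    (f : EuclideanSpace ℝ (Fin d) → ℝ) :
    (ballVol d x r)⁻¹ * ∫ y in ball x r, f y =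
      (ballVol d 0 1)⁻¹ * ∫ y in ball 0 1, f (x + r • y) := by
  have hvol : ballVol d x r = r ^ d * ballVol d 0 1 := by
    simp [ballVol, Measure.addHaar_ball_of_pos volume x hr, hr.le]
  have htrans : ∫ y in ball 0 r, f (x + y) = ∫ y in ball x r, f y := by
    have := (measurePreserving_add_left volume x).setIntegral_preimage_emb
      (measurableEmbedding_addLeft x) f (ball x r)
    simpa [preimage_add_ball] using this
  rw [Measure.setIntegral_comp_smul_of_pos volume (fun y => f (x + y)) _ hr, smul_unitBall hr.ne',
    Real.norm_of_nonneg hr.le, htrans, hvol, finrank_euclideanSpace_fin, mul_inv, smul_eq_mul]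
  ring

/-- A polynomial is bounded on every ball by a multiple of the average of its absolute value. -/
theorem exists_forall_abs_eval_le_mul_average (d : ℕ) (P : MvPolynomial (Fin d) ℝ) :
    ∃ C > (0 : ℝ), ∀ (x : EuclideanSpace ℝ (Fin d)) (r : ℝ), 0 < r → ∀ z ∈ ball x r,
      |MvPolynomial.eval (fun i => z i) P| ≤
        C * ((ballVol d x r)⁻¹ * ∫ y in ball x r, |MvPolynomial.eval (fun i => y i) P|) := by
  let V := MvPolynomial.restrictTotalDegree (Fin d) ℝ P.totalDegree
  obtain ⟨C, hC, h⟩ := exists_forall_abs_le_mul_setIntegral_abs volume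
    (evalContinuousMap d ∘ₗ V.subtype) isOpen_ball
    (isCompact_closedBall (0 : EuclideanSpace ℝ (Fin d)) 1) ball_subset_closedBall
    measurableSet_closedBall fun v hv => by
      refine Subtype.ext (eq_zero_of_eval_eq_zero_of_isOpen
        (U := WithLp.toLp 2 ⁻¹' ball (0 : EuclideanSpace ℝ (Fin d)) 1)
        (isOpen_ball.preimage (PiLp.continuous_toLp 2 _)) ⟨0, by simp⟩ fun y hy => ?_)
      exact hv _ hy
  have hB := ballVol_pos d 0 one_pos
  refine ⟨C * ballVol d 0 1, by positivity, fun x r hr z hz => ?_⟩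
  let f : Fin d → MvPolynomial (Fin d) ℝ :=
    fun i => MvPolynomial.C (x i) + MvPolynomial.C r * MvPolynomial.X i
  have hf (i) : (f i).totalDegree ≤ 1 := by
    refine (MvPolynomial.totalDegree_add _ _).trans (max_le (by simp) ?_)
    exact (MvPolynomial.totalDegree_mul _ _).trans (by simp)
  have heval (y : EuclideanSpace ℝ (Fin d)) :
      MvPolynomial.eval (fun i => y i) (MvPolynomial.aeval f P) =
        MvPolynomial.eval (fun i => (x + r • y) i) P := by
    rw [← MvPolynomial.coe_aeval_eq_eval, ← MvPolynomial.coe_aeval_eq_eval, RingHom.coe_coe,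
      RingHom.coe_coe, ← AlgHom.comp_apply, MvPolynomial.comp_aeval]
    simp [f]
  have hmem : r⁻¹ • (z - x) ∈ closedBall (0 : EuclideanSpace ℝ (Fin d)) 1 := by
    rw [mem_closedBall_zero_iff, norm_smul, norm_inv, Real.norm_of_nonneg hr.le,
      inv_mul_le_iff₀ hr, mul_one, ← dist_eq_norm]
    exact (mem_ball.1 hz).le
  have key := h ⟨MvPolynomial.aeval f P, (MvPolynomial.mem_restrictTotalDegree _ _ _).2
    (totalDegree_aeval_le_of_forall_le_one f hf P)⟩ _ hmem
  simp only [LinearMap.comp_apply, Submodule.subtype_apply, evalContinuousMap_apply, heval,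
    smul_inv_smul₀ hr.ne', add_sub_cancel] at key
  rwa [inv_ballVol_mul_setIntegral d x hr, mul_assoc, mul_inv_cancel_left₀ hB.ne']

/-- Every nonnegative polynomial on `ℝ^d` belongs to the reverse Hölder class
`RH_q(ℝ^d)` for every `1 < q < ∞`. -/
theorem statement15 (d : ℕ) (hd : 1 ≤ d) (P : MvPolynomial (Fin d) ℝ)
    (hP : ∀ x : EuclideanSpace ℝ (Fin d), 0 ≤ MvPolynomial.eval (fun i => x i) P)
    (q : ℝ) (hq : 1 < q) :
    ∃ C > (0:ℝ), ∀ (x : EuclideanSpace ℝ (Fin d)) (r : ℝ), 0 < r →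
      ((ballVol d x r)⁻¹ *
          ∫ y in ball x r, (MvPolynomial.eval (fun i => y i) P) ^ q) ^ (1/q) ≤
        C * ((ballVol d x r)⁻¹ * ∫ y in ball x r, MvPolynomial.eval (fun i => y i) P) := by
  obtain ⟨C, hC, h⟩ := exists_forall_abs_eval_le_mul_average d P
  refine ⟨C, hC, fun x r hr => ?_⟩
  have hB := ballVol_pos d x hr
  have hq0 : 0 < q := one_pos.trans hq
  set A := (ballVol d x r)⁻¹ * ∫ y in ball x r, MvPolynomial.eval (fun i => y i) P
  have hA : 0 ≤ C * A :=
    mul_nonneg hC.le (mul_nonneg (inv_nonneg.2 hB.le) (integral_nonneg hP))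
  have hle : ∀ y ∈ ball x r, ‖MvPolynomial.eval (fun i => y i) P ^ q‖ ≤ (C * A) ^ q := by
    intro y hy
    rw [Real.norm_of_nonneg (Real.rpow_nonneg (hP y) q)]
    refine Real.rpow_le_rpow (hP y) ?_ hq0.le
    simpa only [abs_of_nonneg (hP _)] using h x r hr y hy
  have hint := (le_abs_self _).trans
    (norm_setIntegral_le_of_norm_le_const (μ := volume) measure_ball_lt_top hle)
  rw [one_div, Real.rpow_inv_le_iff_of_pos _ hA hq0, inv_mul_le_iff₀ hB, mul_comm]
  · exact hint
  · exact mul_nonneg (inv_nonneg.2 hB.le)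
      (integral_nonneg fun y => Real.rpow_nonneg (hP y) q)
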